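/- (Lower bound, dense regime) Let p ≥ 1 and C₀ > 0. Then there exists a constant c > 0 depending only on p and C₀ such that the following holds. Suppose N, M, W, L ∈ ℕ satisfy W ≥ 2, L ≥ 1 and N ≤ M ≤ C₀·N^p, and suppose that for every x = (x₁,…,x_N) ∈ ℤ^N with Σ_{n=1}^N |x_n| ≤ M there exists g ∈ NN_{1,1}(W, L) with g(n) = x_n for all n = 1,…,N. Then W²L²·log(WL) ≥ c·N·(1 + log(M/N)), where log is the natural logarithm. -/

import Mathlib

open MeasureTheory ENNReal Finset

noncomputable section

/-- The ReLU activation function. -/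
def relu (t : ℝ) : ℝ := max t 0

/-- `A` is an affine map `ℝ^n → ℝ^m`. -/
def IsAffineMap {n m : ℕ} (A : (Fin n → ℝ) → (Fin m → ℝ)) : Prop :=
  ∃ (M : Matrix (Fin m) (Fin n) ℝ) (c : Fin m → ℝ),
    ∀ x i, A x i = (∑ j, M i j * x j) + c i

/-- Auxiliary definition of the ReLU network class, by recursion on the number
of hidden layers. -/
def NNaux (k W : ℕ) : ℕ → (d : ℕ) → Set ((Fin d → ℝ) → (Fin k → ℝ))
  | 0, _ => {g | IsAffineMap g}
  | (L + 1), d => {g | ∃ N : ℕ, 1 ≤ N ∧ N ≤ W ∧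
      ∃ (A : (Fin d → ℝ) → (Fin N → ℝ)) (h : (Fin N → ℝ) → (Fin k → ℝ)),
        IsAffineMap A ∧ h ∈ NNaux k W L N ∧
        g = fun x => h (fun i => relu (A x i))}

/-- The class `NN_{d,k}(W,L)` of functions `ℝ^d → ℝ^k` computed by fully connected
ReLU networks with width at most `W` and `L` hidden layers. -/
def NN (d k W L : ℕ) : Set ((Fin d → ℝ) → (Fin k → ℝ)) := NNaux k W L d

end

/-- More polynomials of bounded degree than there are variables are algebraically dependent, with
an explicit bound on the exponents of the relation. -/
lemma exists_bounded_algebraic_relation {ι : Type*} [Fintype ι] [DecidableEq ι] {D B : ℕ}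
    (hB : (Fintype.card ι * D + 1) ^ Fintype.card ι ≤ B)
    (f : ι → MvPolynomial ι ℝ) (hf : ∀ i, (f i).totalDegree ≤ D)
    (u : MvPolynomial ι ℝ) (hu : u.totalDegree ≤ 1) :
    ∃ c : (ι → Fin (B + 1)) × Fin (B + 1) → ℝ, c ≠ 0 ∧
      ∑ a, c a • ((∏ i, f i ^ (a.1 i : ℕ)) * u ^ (a.2 : ℕ)) = 0 := by
  set n := Fintype.card ι with hn
  set E := (n * D + 1) * B with hE
  let P : (ι → Fin (B + 1)) × Fin (B + 1) → MvPolynomial ι ℝ :=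
    fun a => (∏ i, f i ^ (a.1 i : ℕ)) * u ^ (a.2 : ℕ)
  have hP : ∀ a, (P a).totalDegree ≤ E := by
    intro a
    refine (MvPolynomial.totalDegree_mul _ _).trans ?_
    have h1 : (∏ i, f i ^ (a.1 i : ℕ)).totalDegree ≤ n * (B * D) := by
      refine (MvPolynomial.totalDegree_finsetProd _ _).trans ?_
      refine (Finset.sum_le_card_nsmul _ _ (B * D) ?_).trans (by simp [hn])
      intro i _
      refine (MvPolynomial.totalDegree_pow _ _).trans ?_
      exact Nat.mul_le_mul (Nat.lt_succ_iff.mp (a.1 i).2) (hf i)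
    have h2 : (u ^ (a.2 : ℕ)).totalDegree ≤ B * 1 :=
      (MvPolynomial.totalDegree_pow _ _).trans
        (Nat.mul_le_mul (Nat.lt_succ_iff.mp a.2.2) hu)
    calc _ ≤ n * (B * D) + B * 1 := add_le_add h1 h2
      _ = E := by rw [hE]; ring
  let T : ((ι → Fin (B + 1)) × Fin (B + 1) → ℝ) →ₗ[ℝ] ((ι → Fin (E + 1)) → ℝ) :=
    LinearMap.pi fun m =>
      (MvPolynomial.lcoeff ℝ (Finsupp.equivFunOnFinite.symm fun i => (m i : ℕ))) ∘ₗ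
        (Fintype.linearCombination ℝ P)
  have hlt : Module.finrank ℝ ((ι → Fin (E + 1)) → ℝ)
      < Module.finrank ℝ ((ι → Fin (B + 1)) × Fin (B + 1) → ℝ) := by
    simp only [Module.finrank_fintype_fun_eq_card, Fintype.card_prod, Fintype.card_fun,
      Fintype.card_fin]
    rw [← hn]
    calc (E + 1) ^ n ≤ ((n * D + 1) * (B + 1)) ^ n := by
          apply Nat.pow_le_pow_left
          rw [hE]; nlinarith
      _ = (n * D + 1) ^ n * (B + 1) ^ n := mul_pow _ _ _
      _ ≤ B * (B + 1) ^ n := Nat.mul_le_mul_right _ hB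
      _ < (B + 1) ^ n * (B + 1) := by
          have : 0 < (B + 1) ^ n := by positivity
          nlinarith
  obtain ⟨c, hc, hc0⟩ := (Submodule.ne_bot_iff _).mp (LinearMap.ker_ne_bot_of_finrank_lt hlt (f := T))
  refine ⟨c, hc0, ?_⟩
  have hdeg : (∑ a, c a • P a).totalDegree ≤ E :=
    MvPolynomial.totalDegree_finsetSum_le fun a _ =>
      (MvPolynomial.totalDegree_smul_le _ _).trans (hP a)
  change ∑ a, c a • P a = 0
  ext m
  rw [MvPolynomial.coeff_zero]
  by_cases hm : ∀ i, m i ≤ E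
  · have := congrFun (LinearMap.mem_ker.mp hc) fun i => ⟨m i, Nat.lt_succ_iff.mpr (hm i)⟩
    simpa [T, Fintype.linearCombination_apply, MvPolynomial.coeff_sum] using this
  · push Not at hm
    obtain ⟨i, hi⟩ := hm
    apply MvPolynomial.coeff_eq_zero_of_totalDegree_lt
    refine hdeg.trans_lt (hi.trans_le ?_)
    refine Finset.single_le_sum (f := fun i => m i) (fun _ _ => Nat.zero_le _) ?_
    rw [Finsupp.mem_support_iff]; omega

/-- Finitely many points can be separated by one of the linear forms `x ↦ ∑ t ^ i * x i`. -/
lemma exists_separating_linear_form {ι S : Type*} [Fintype ι] [Fintype S] {n : ℕ} (e : ι ≃ Fin n) :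
    ∃ T : ℕ, ∀ x : S → ι → ℝ, Function.Injective x →
      ∃ t < T, Function.Injective fun s => ∑ i, (t : ℝ) ^ (e i : ℕ) * x s i := by
  classical
  refine ⟨Fintype.card (S × S) * n + 1, fun x hx => ?_⟩
  let q : S × S → Polynomial ℝ := fun a =>
    if a.1 = a.2 then 1 else ∑ i, Polynomial.monomial (e i : ℕ) (x a.1 i - x a.2 i)
  have hq : ∀ a, q a ≠ 0 := by
    intro a
    by_cases h : a.1 = a.2
    · simp [q, h]
    · have : x a.1 ≠ x a.2 := fun h' => h (hx h')
      obtain ⟨i, hi⟩ := Function.ne_iff.mp this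
      intro h0
      have := congrArg (fun p => p.coeff (e i : ℕ)) h0
      simp only [q, h, if_false, Polynomial.finsetSum_coeff, Polynomial.coeff_monomial,
        Polynomial.coeff_zero, Fin.val_inj, e.injective.eq_iff, Finset.sum_ite_eq',
        Finset.mem_univ, if_true] at this
      exact hi (sub_eq_zero.mp this)
  have hdeg : ∀ a, (q a).natDegree ≤ n := by
    intro a
    by_cases h : a.1 = a.2
    · simp [q, h]
    · simp only [q, h, if_false]
      exact Polynomial.natDegree_sum_le_of_forall_le _ _ fun i _ =>
        (Polynomial.natDegree_monomial_le _).trans (e i).2.le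
  have hprod : ∏ a, q a ≠ 0 := Finset.prod_ne_zero_iff.mpr fun a _ => hq a
  have hpdeg : (∏ a, q a).natDegree < Fintype.card (S × S) * n + 1 := by
    refine Nat.lt_succ_iff.mpr ((Polynomial.natDegree_prod_le _ _).trans ?_)
    refine (Finset.sum_le_card_nsmul _ _ n fun a _ => hdeg a).trans (by simp)
  obtain ⟨t, ht, hne⟩ : ∃ t < Fintype.card (S × S) * n + 1, (∏ a, q a).eval (t : ℝ) ≠ 0 := by
    by_contra! h
    refine hprod (Polynomial.eq_zero_of_natDegree_lt_card_of_eval_eq_zero _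
      (f := fun t : Fin (Fintype.card (S × S) * n + 1) => ((t : ℕ) : ℝ)) ?_ (fun t => h t t.2)
      (by simpa using hpdeg))
    intro a b hab
    exact Fin.ext (Nat.cast_injective hab)
  refine ⟨t, ht, fun s s' hs => ?_⟩
  by_contra hss
  rw [Polynomial.eval_prod, Finset.prod_ne_zero_iff] at hne
  apply hne (s, s') (Finset.mem_univ _)
  simp only [q, hss, if_false, Polynomial.eval_finsetSum, Polynomial.eval_monomial]
  simp only [sub_mul, Finset.sum_sub_distrib]
  rw [sub_eq_zero]
  simpa [mul_comm] using hs

/-- If the system `f = ε` has a family of distinct solutions indexed by `S` for all small `ε`,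
then the size of `S` is bounded in terms of the degrees. -/
lemma card_le_of_forall_small_solutions {ι S : Type*} [Fintype ι] [Fintype S] {D : ℕ}
    (f : ι → MvPolynomial ι ℝ) (hf : ∀ i, (f i).totalDegree ≤ D) {η : ℝ} (hη : 0 < η)
    (H : ∀ ε : ι → ℝ, (∀ i, |ε i| < η) → ∃ x : S → ι → ℝ, Function.Injective x ∧
      ∀ s i, MvPolynomial.eval (x s) (f i) = ε i) :
    Fintype.card S ≤ (Fintype.card ι * D + 1) ^ Fintype.card ι := by
  classical
  set B := (Fintype.card ι * D + 1) ^ Fintype.card ι with hB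
  let e := Fintype.equivFin ι
  obtain ⟨T, hT⟩ := exists_separating_linear_form (S := S) e
  let u : ℕ → MvPolynomial ι ℝ := fun t => ∑ i, MvPolynomial.C ((t : ℝ) ^ (e i : ℕ)) * MvPolynomial.X i
  have hu : ∀ t, (u t).totalDegree ≤ 1 := fun t =>
    MvPolynomial.totalDegree_finsetSum_le fun i _ =>
      (MvPolynomial.totalDegree_mul _ _).trans (by rw [MvPolynomial.totalDegree_C]; simp)
  choose c hc0 hc using fun t => exists_bounded_algebraic_relation hB.ge f hf (u t) (hu t)
  let q : ℕ → Fin (B + 1) → MvPolynomial ι ℝ := fun t j =>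
    ∑ a : ι → Fin (B + 1), MvPolynomial.monomial
      (Finsupp.equivFunOnFinite.symm fun i => (a i : ℕ)) (c t (a, j))
  have hq : ∀ t, ∃ j, q t j ≠ 0 := by
    intro t
    obtain ⟨⟨a, j⟩, haj⟩ := Function.ne_iff.mp (hc0 t)
    refine ⟨j, fun h0 => haj ?_⟩
    have := congrArg (MvPolynomial.coeff (Finsupp.equivFunOnFinite.symm fun i => (a i : ℕ))) h0
    simp only [q, MvPolynomial.coeff_sum, MvPolynomial.coeff_monomial, MvPolynomial.coeff_zero]
      at this
    rw [Finset.sum_eq_single a] at this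
    · simpa using this
    · intro b _ hb
      rw [if_neg]
      intro h
      apply hb
      have h' := Finsupp.equivFunOnFinite.symm.injective h
      funext i
      exact Fin.ext (congrFun h' i)
    · simp
  choose j hj using hq
  have hprod : ∏ t ∈ Finset.range T, q t (j t) ≠ 0 :=
    Finset.prod_ne_zero_iff.mpr fun t _ => hj t
  obtain ⟨ε, hε, hne⟩ : ∃ ε : ι → ℝ, (∀ i, |ε i| < η) ∧
      MvPolynomial.eval ε (∏ t ∈ Finset.range T, q t (j t)) ≠ 0 := by
    by_contra! h
    refine hprod (MvPolynomial.funext_set (fun _ => Set.Ioo (-η) η)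
      (fun _ => Set.Ioo_infinite (by linarith)) ?_)
    intro x hx
    rw [map_zero]
    exact h x fun i => abs_lt.mpr (hx i (Set.mem_univ i))
  obtain ⟨x, hx, hxe⟩ := H ε hε
  obtain ⟨t, ht, hinj⟩ := hT x hx
  rw [map_prod, Finset.prod_ne_zero_iff] at hne
  have hqt := hne t (Finset.mem_range.mpr ht)
  let r : Polynomial ℝ := ∑ k : Fin (B + 1), Polynomial.monomial (k : ℕ) (MvPolynomial.eval ε (q t k))
  have hr : r ≠ 0 := by
    intro h0
    have := congrArg (fun p => p.coeff (j t : ℕ)) h0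
    simp only [r, Polynomial.finsetSum_coeff, Polynomial.coeff_monomial, Polynomial.coeff_zero,
      Fin.val_inj, Finset.sum_ite_eq', Finset.mem_univ, if_true] at this
    exact hqt this
  have hrdeg : r.natDegree ≤ B :=
    Polynomial.natDegree_sum_le_of_forall_le _ _ fun k _ =>
      (Polynomial.natDegree_monomial_le _).trans (Nat.lt_succ_iff.mp k.2)
  have hroot : ∀ s, r.eval (∑ i, (t : ℝ) ^ (e i : ℕ) * x s i) = 0 := by
    intro s
    have h := congrArg (MvPolynomial.eval (x s)) (hc t)
    simp only [map_sum, MvPolynomial.smul_eval, map_mul, map_prod, map_pow, hxe, map_zero,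
      u, MvPolynomial.eval_C, MvPolynomial.eval_X, Fintype.sum_prod_type_right] at h
    simp only [r, q, Polynomial.eval_finsetSum, Polynomial.eval_monomial, map_sum,
      MvPolynomial.eval_monomial]
    rw [← h]
    refine Finset.sum_congr rfl fun k _ => Finset.sum_congr rfl fun a _ => ?_
    rw [Finsupp.prod_fintype _ _ (by simp)]
    simp [mul_assoc]
  by_contra! hlt
  exact hr (Polynomial.eq_zero_of_natDegree_lt_card_of_eval_eq_zero r hinj hroot
    (hrdeg.trans_lt hlt))

lemma totalDegree_pderiv_le {ι : Type*} (p : MvPolynomial ι ℝ) (i : ι) :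
    (MvPolynomial.pderiv i p).totalDegree ≤ p.totalDegree := by
  classical
  conv_lhs => rw [p.as_sum, map_sum]
  refine MvPolynomial.totalDegree_finsetSum_le fun s hs => ?_
  rw [MvPolynomial.pderiv_monomial]
  refine (MvPolynomial.totalDegree_monomial_le _ _).trans
    (le_trans ?_ (MvPolynomial.le_totalDegree hs))
  change (s - Finsupp.single i 1).sum (fun _ e => e) ≤ s.sum fun _ e => e
  refine (Finsupp.sum_le_sum_index (tsub_le_self) ?_ ?_)
  · intro _ _ _ _ h; exact h
  · simp

lemma hasDerivAt_eval_update {ι : Type*} [DecidableEq ι] (p : MvPolynomial ι ℝ) (i : ι) (x : ι → ℝ)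
    (a : ℝ) :
    HasDerivAt (fun t => MvPolynomial.eval (Function.update x i t) p)
      (MvPolynomial.eval (Function.update x i a) (MvPolynomial.pderiv i p)) a := by
  induction p using MvPolynomial.induction_on with
  | C r => simpa using hasDerivAt_const a r
  | add p q hp hq => simpa using! hp.add hq
  | mul_X p k hp =>
    have hX : HasDerivAt (fun t => Function.update x i t k)
        (MvPolynomial.eval (Function.update x i a) (MvPolynomial.pderiv i (MvPolynomial.X k))) a := by
      by_cases hk : k = i
      · subst hk; simpa using hasDerivAt_id' a
      · simpa [hk, MvPolynomial.pderiv_X, Pi.single_apply, Ne.symm hk] using! hasDerivAt_const a (x k)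
    have := hp.mul hX
    simp only [MvPolynomial.eval_mul, MvPolynomial.eval_X, Derivation.leibniz, smul_eq_mul, map_add]
    convert! this using 1
    simp; ring

/-- If a polynomial `F` is nonzero at a point `r` of an open set `U` inside a compact set `K`, and
vanishes on `K \ U`, then `grad F` takes all small values on `U`. -/
lemma exists_pderiv_eq_of_vanishing_boundary {ι : Type*} [Fintype ι]
    (F : MvPolynomial ι ℝ) {U K : Set (ι → ℝ)} (hU : IsOpen U) (hK : IsCompact K) (hUK : U ⊆ K)
    (hF : ∀ x ∈ K, x ∉ U → MvPolynomial.eval x F = 0)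
    {r : ι → ℝ} (hr : r ∈ U) (hFr : MvPolynomial.eval r F ≠ 0) :
    ∃ η > 0, ∀ ε : ι → ℝ, (∀ i, |ε i| < η) →
      ∃ x ∈ U, ∀ i, MvPolynomial.eval x (MvPolynomial.pderiv i F) = ε i := by
  classical
  obtain ⟨R, hR⟩ := hK.isBounded.exists_norm_le
  have hR0 : 0 ≤ R := (norm_nonneg _).trans (hR r (hUK hr))
  obtain ⟨τ, hτ, hτ0⟩ : ∃ τ : ℝ, τ * MvPolynomial.eval r F = |MvPolynomial.eval r F| ∧ τ ≠ 0 ∧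
      |τ| = 1 := by
    rcases lt_or_gt_of_ne hFr with h | h
    · exact ⟨-1, by rw [abs_of_neg h]; ring, by norm_num, by norm_num⟩
    · exact ⟨1, by rw [abs_of_pos h]; ring, by norm_num, by norm_num⟩
  set n : ℝ := (Fintype.card ι : ℝ)
  have hn0 : 0 ≤ n := by positivity
  set v := |MvPolynomial.eval r F| with hv
  have hv0 : 0 < v := abs_pos.mpr hFr
  set η := v / (2 * (n * R) + 1) with hη
  have hη0 : 0 < η := by positivity
  refine ⟨η, hη0, fun ε hε => ?_⟩
  have hlin : ∀ x ∈ K, |τ * ∑ i, ε i * x i| ≤ η * (n * R) := by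
    intro x hx
    rw [abs_mul, hτ0.2, one_mul]
    refine (Finset.abs_sum_le_sum_abs _ _).trans ?_
    refine (Finset.sum_le_card_nsmul _ _ (η * R) fun i _ => ?_).trans ?_
    · rw [abs_mul]
      exact mul_le_mul (hε i).le ((norm_le_pi_norm x i).trans (hR x hx)) (abs_nonneg _) hη0.le
    · rw [nsmul_eq_mul, Finset.card_univ]; exact le_of_eq (by ring)
  have hlt : 2 * (η * (n * R)) < v := by
    have : η * (2 * (n * R) + 1) = v := by rw [hη]; field_simp
    nlinarith
  let Φ : (ι → ℝ) → ℝ := fun x => τ * (MvPolynomial.eval x F - ∑ i, ε i * x i)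
  have hΦ : Continuous Φ :=
    continuous_const.mul ((MvPolynomial.continuous_eval F).sub (by fun_prop))
  obtain ⟨y, hyK, hy⟩ := hK.exists_isMaxOn ⟨r, hUK hr⟩ hΦ.continuousOn
  have hyU : y ∈ U := by
    by_contra hyU
    have h1 : Φ r ≤ Φ y := hy (hUK hr)
    simp only [Φ, mul_sub, hF y hyK hyU, hτ] at h1
    have h2 := abs_le.mp (hlin y hyK)
    have h3 := abs_le.mp (hlin r (hUK hr))
    linarith [h2.1, h2.2, h3.1, h3.2]
  refine ⟨y, hyU, fun i => ?_⟩
  have hcont : ContinuousAt (fun t => Function.update y i t) (y i) :=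
    (continuous_const.update i continuous_id).continuousAt
  have hloc : IsLocalMax (fun t => Φ (Function.update y i t)) (y i) := by
    have : ∀ᶠ t in nhds (y i), Function.update y i t ∈ U := by
      apply hcont.eventually_mem
      rw [Function.update_eq_self]
      exact hU.mem_nhds hyU
    filter_upwards [this] with t ht
    rw [Function.update_eq_self]
    exact hy (hUK ht)
  have hd1 := hasDerivAt_eval_update F i y (y i)
  have hd2 := hasDerivAt_eval_update (∑ k, MvPolynomial.C (ε k) * MvPolynomial.X k) i y (y i)
  have hd := (hd1.sub hd2).const_mul τ
  rw [Function.update_eq_self] at hd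
  have h0 : τ * _ = 0 := hloc.hasDerivAt_eq_zero (by
    convert! hd using 1
    funext t
    simp [Φ])
  have h1 := (mul_eq_zero.mp h0).resolve_left hτ0.1
  rw [sub_eq_zero] at h1
  rw [h1]
  simp [MvPolynomial.pderiv_X, Pi.single_apply]

/-- A Warren-type bound on the number of sign patterns of a family of polynomials. -/
theorem ncard_range_sign_patterns_le {ι κ : Type*} [Fintype ι] [Fintype κ] {d : ℕ}
    (p : κ → MvPolynomial ι ℝ) (hp : ∀ k, (p k).totalDegree ≤ d) :
    (Set.range fun (θ : ι → ℝ) (k : κ) => 0 < MvPolynomial.eval θ (p k)).ncard ≤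
      (Fintype.card ι * (Fintype.card κ * d + 2) + 1) ^ Fintype.card ι := by
  classical
  set S := Set.range fun (θ : ι → ℝ) (k : κ) => 0 < MvPolynomial.eval θ (p k) with hS
  have : Fintype S := Fintype.ofFinite S
  choose r hr using fun s : S => s.2
  have hr' : ∀ (s : S) k, 0 < MvPolynomial.eval (r s) (p k) ↔ s.1 k := fun s k =>
    iff_of_eq (congrFun (hr s) k)
  obtain ⟨δ, hδ0, hδ⟩ : ∃ δ > 0, ∀ (s : S) k, 0 < MvPolynomial.eval (r s) (p k) →
      δ < MvPolynomial.eval (r s) (p k) := by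
    have : ∀ᶠ δ in nhdsWithin (0 : ℝ) (Set.Ioi 0), ∀ (s : S) k,
        0 < MvPolynomial.eval (r s) (p k) → δ < MvPolynomial.eval (r s) (p k) := by
      simp only [Filter.eventually_all]
      intro s k h
      exact mem_nhdsWithin_of_mem_nhds (Iio_mem_nhds h)
    obtain ⟨δ, h1, h2⟩ := (this.and self_mem_nhdsWithin).exists
    exact ⟨δ, h2, h1⟩
  obtain ⟨R, hR⟩ : ∃ R : ℝ, ∀ s : S, ∑ i, r s i ^ 2 < R := by
    obtain ⟨R, hR⟩ := (Set.finite_range fun s : S => ∑ i, r s i ^ 2).bddAbove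
    exact ⟨R + 1, fun s => (hR ⟨s, rfl⟩).trans_lt (by linarith)⟩
  let q : MvPolynomial ι ℝ := MvPolynomial.C R - ∑ i, MvPolynomial.X i ^ 2
  let p' : κ → MvPolynomial ι ℝ := fun k => p k - MvPolynomial.C δ
  let F := q * ∏ k, p' k
  have hFdeg : F.totalDegree ≤ Fintype.card κ * d + 2 := by
    refine (MvPolynomial.totalDegree_mul _ _).trans ?_
    rw [add_comm]
    refine add_le_add ?_ ?_
    · refine (MvPolynomial.totalDegree_finsetProd _ _).trans ?_
      refine (Finset.sum_le_card_nsmul _ _ d fun k _ => ?_).trans (by simp)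
      exact (MvPolynomial.totalDegree_sub_C_le _ _).trans (hp k)
    · refine (MvPolynomial.totalDegree_sub _ _).trans (max_le (by rw [MvPolynomial.totalDegree_C]; simp) ?_)
      exact MvPolynomial.totalDegree_finsetSum_le fun i _ => (MvPolynomial.totalDegree_X_pow _ _).le
  have hq : ∀ x, MvPolynomial.eval x q = R - ∑ i, x i ^ 2 := fun x => by simp [q]
  have hp' : ∀ x k, MvPolynomial.eval x (p' k) = MvPolynomial.eval x (p k) - δ := fun x k => by
    simp [p']
  have hF : ∀ x, MvPolynomial.eval x F =
      (R - ∑ i, x i ^ 2) * ∏ k, (MvPolynomial.eval x (p k) - δ) := fun x => by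
    simp only [F, map_mul, map_prod, hq, hp']
  let sg : S → κ → ℝ := fun s k => if s.1 k then 1 else -1
  have hsg : ∀ s k, sg s k ≠ 0 := fun s k => by simp only [sg]; split_ifs <;> norm_num
  let g : κ → (ι → ℝ) → ℝ := fun k x => MvPolynomial.eval x (p k) - δ
  have hg : ∀ k, Continuous (g k) := fun k =>
    (MvPolynomial.continuous_eval (p k)).sub continuous_const
  let U : S → Set (ι → ℝ) := fun s => {x | ∑ i, x i ^ 2 < R} ∩ ⋂ k, {x | 0 < sg s k * g k x}
  let K : S → Set (ι → ℝ) := fun s => {x | ∑ i, x i ^ 2 ≤ R} ∩ ⋂ k, {x | 0 ≤ sg s k * g k x}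
  have hsq : Continuous fun x : ι → ℝ => ∑ i, x i ^ 2 := by fun_prop
  have hUo : ∀ s, IsOpen (U s) := fun s =>
    (isOpen_lt hsq continuous_const).inter
      (isOpen_iInter_of_finite fun k => isOpen_lt continuous_const (continuous_const.mul (hg k)))
  have hKc : ∀ s, IsCompact (K s) := by
    intro s
    refine Metric.isCompact_of_isClosed_isBounded ?_ ?_
    · exact (isClosed_le hsq continuous_const).inter
        (isClosed_iInter fun k => isClosed_le continuous_const (continuous_const.mul (hg k)))
    · refine isBounded_iff_forall_norm_le.mpr ⟨R + 1, fun x hx => ?_⟩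
      have hR0 : 0 ≤ R := (Finset.sum_nonneg fun i _ => sq_nonneg (x i)).trans hx.1
      refine (pi_norm_le_iff_of_nonneg (by linarith)).mpr fun i => ?_
      have : x i ^ 2 ≤ R := (Finset.single_le_sum (f := fun i => x i ^ 2)
        (fun i _ => sq_nonneg (x i)) (Finset.mem_univ i)).trans hx.1
      rw [Real.norm_eq_abs]
      exact abs_le_of_sq_le_sq (by nlinarith) (by linarith)
  have hUK : ∀ s, U s ⊆ K s := by
    rintro s x ⟨hxR, hx⟩
    exact ⟨(show ∑ i, x i ^ 2 < R from hxR).le, Set.mem_iInter.mpr fun k =>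
      (show 0 < sg s k * g k x from Set.mem_iInter.mp hx k).le⟩
  have hb : ∀ s, ∀ x ∈ K s, x ∉ U s → MvPolynomial.eval x F = 0 := by
    intro s x hx hxU
    rw [hF]
    by_contra hne
    obtain ⟨h1, h2⟩ := mul_ne_zero_iff.mp hne
    rw [Finset.prod_ne_zero_iff] at h2
    refine hxU ⟨lt_of_le_of_ne hx.1 fun h => h1 (sub_eq_zero.mpr h.symm), Set.mem_iInter.mpr fun k => ?_⟩
    exact lt_of_le_of_ne (Set.mem_iInter.mp hx.2 k)
      (mul_ne_zero (hsg s k) (h2 k (Finset.mem_univ k))).symm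
  have hrU : ∀ s, r s ∈ U s := by
    intro s
    refine ⟨hR s, Set.mem_iInter.mpr fun k => ?_⟩
    by_cases h : s.1 k
    · have := hδ s k ((hr' s k).mpr h)
      simp only [Set.mem_ofPred_eq, sg, g, h, if_true]; linarith
    · have := not_lt.mp (mt (hr' s k).mp h)
      simp only [Set.mem_ofPred_eq, sg, g, h, if_false]; linarith
  have hFr : ∀ s, MvPolynomial.eval (r s) F ≠ 0 := by
    intro s
    rw [hF]
    refine mul_ne_zero (sub_pos.mpr (hrU s).1).ne' (Finset.prod_ne_zero_iff.mpr fun k _ h => ?_)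
    have := Set.mem_iInter.mp (hrU s).2 k
    simp [g, h] at this
  choose η hη0 hη using fun s => exists_pderiv_eq_of_vanishing_boundary F (hUo s) (hKc s) (hUK s)
    (hb s) (hrU s) (hFr s)
  obtain ⟨η', hη'0, hη'⟩ : ∃ η' > 0, ∀ s, η' < η s := by
    have : ∀ᶠ δ in nhdsWithin (0 : ℝ) (Set.Ioi 0), ∀ s : S, δ < η s := by
      simp only [Filter.eventually_all]
      intro s
      exact mem_nhdsWithin_of_mem_nhds (Iio_mem_nhds (hη0 s))
    obtain ⟨δ, h1, h2⟩ := (this.and self_mem_nhdsWithin).exists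
    exact ⟨δ, h2, h1⟩
  rw [← Nat.card_coe_set_eq, Nat.card_eq_fintype_card]
  refine card_le_of_forall_small_solutions (fun i => MvPolynomial.pderiv i F)
    (fun i => (totalDegree_pderiv_le F i).trans hFdeg) hη'0 fun ε hε => ?_
  choose x hxU hx using fun s => hη s ε fun i => (hε i).trans (hη' s)
  refine ⟨x, fun s s' hss => ?_, hx⟩
  apply Subtype.ext
  funext k
  have h1 := Set.mem_iInter.mp (hxU s).2 k
  have h2 := Set.mem_iInter.mp (hxU s').2 k
  rw [← hss] at h2
  simp only [Set.mem_ofPred_eq, sg] at h1 h2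
  by_cases ha : s.1 k <;> by_cases hb : s'.1 k <;> simp only [ha, hb, if_true, if_false] at h1 h2 ⊢ <;>
    linarith

/-- The affine map of a layer of width `W`; the entry at `none` is the bias. -/
def affineLayer {W : ℕ} (A : Fin W → Option (Fin W) → ℝ) (v : Fin W → ℝ) (i : Fin W) : ℝ :=
  (∑ j, A i (some j) * v j) + A i none

/-- The activations after `ℓ` hidden layers of a network of constant width `W` and weights `θ`. -/
noncomputable def activation {W : ℕ} (θ : ℕ → Fin W → Option (Fin W) → ℝ) (v : Fin W → ℝ) :
    ℕ → Fin W → ℝ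
  | 0 => v
  | ℓ + 1 => fun i => relu (affineLayer (θ ℓ) (activation θ v ℓ) i)

lemma activation_succ_shift {W : ℕ} (θ : ℕ → Fin W → Option (Fin W) → ℝ) (v : Fin W → ℝ) (ℓ : ℕ) :
    activation θ v (ℓ + 1) = activation (fun k => θ (k + 1)) (activation θ v 1) ℓ := by
  induction ℓ with
  | zero => rfl
  | succ ℓ ih => rw [activation, ih]; rfl

lemma IsAffineMap.exists_affineLayer {W d N : ℕ} (hd : d ≤ W) (hN : N ≤ W)
    {A : (Fin d → ℝ) → (Fin N → ℝ)} (hA : IsAffineMap A) :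
    ∃ B : Fin W → Option (Fin W) → ℝ, ∀ v i,
      affineLayer B v (Fin.castLE hN i) = A (fun j => v (Fin.castLE hd j)) i := by
  obtain ⟨M, c, h⟩ := hA
  have hiN := Fin.castLE_injective hN
  have hid := Fin.castLE_injective hd
  refine ⟨Function.extend (Fin.castLE hN) (fun i o => o.elim (c i)
    (Function.extend (Fin.castLE hd) (M i) 0)) 0, fun v i => ?_⟩
  rw [h, affineLayer, hiN.extend_apply]
  congr 1
  refine (Fintype.sum_of_injective _ hid _ _ ?_ ?_).symm
  · intro j hj
    simp only [Option.elim_some]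
    rw [Function.extend_apply' _ _ _ hj]
    simp
  · intro j
    simp only [Option.elim_some]
    rw [hid.extend_apply]

lemma exists_weights_of_mem_NNaux {W : ℕ} (hW : 1 ≤ W) (L : ℕ) :
    ∀ (d : ℕ) (hd : d ≤ W), ∀ g ∈ NNaux 1 W L d, ∃ θ : ℕ → Fin W → Option (Fin W) → ℝ,
      ∀ v : Fin W → ℝ, g (fun j => v (Fin.castLE hd j)) 0 =
        affineLayer (θ L) (activation θ v L) (Fin.castLE hW 0) := by
  induction L with
  | zero =>
    intro d hd g hg
    obtain ⟨B, hB⟩ := IsAffineMap.exists_affineLayer hd hW (A := g) hg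
    exact ⟨fun _ => B, fun v => (hB v 0).symm⟩
  | succ L ih =>
    rintro d hd g ⟨N, -, hN, A, h, hA, hh, rfl⟩
    obtain ⟨B, hB⟩ := hA.exists_affineLayer hd hN
    obtain ⟨θ, hθ⟩ := ih N hN h hh
    refine ⟨fun k => Nat.casesOn k B θ, fun v => ?_⟩
    rw [activation_succ_shift]
    refine Eq.trans ?_ (hθ _)
    exact congrArg (fun w => h w 0) (funext fun i => congrArg relu (hB v i).symm)

/-- The index set of the weights of a network with `L` hidden layers of width `W`. -/
abbrev WeightIndex (W L : ℕ) : Type := Fin (L + 1) × Fin W × Option (Fin W)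

/-- The weights of the layers up to `L`, as a vector. -/
def weightVector {W : ℕ} (L : ℕ) (θ : ℕ → Fin W → Option (Fin W) → ℝ) : WeightIndex W L → ℝ :=
  fun a => θ a.1 a.2.1 a.2.2

/-- The affine map of layer `ℓ`, applied to activations that are polynomials in the weights. -/
noncomputable def affineLayerPoly {W L : ℕ} (ℓ : Fin (L + 1))
    (P : Fin W → MvPolynomial (WeightIndex W L) ℝ) (i : Fin W) :
    MvPolynomial (WeightIndex W L) ℝ :=
  (∑ j, MvPolynomial.X (ℓ, i, some j) * P j) + MvPolynomial.X (ℓ, i, none)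

lemma eval_affineLayerPoly {W L : ℕ} (ℓ : Fin (L + 1))
    (P : Fin W → MvPolynomial (WeightIndex W L) ℝ) (θ : ℕ → Fin W → Option (Fin W) → ℝ)
    (i : Fin W) :
    MvPolynomial.eval (weightVector L θ) (affineLayerPoly ℓ P i) =
      affineLayer (θ ℓ) (fun j => MvPolynomial.eval (weightVector L θ) (P j)) i := by
  simp [affineLayerPoly, affineLayer, weightVector]

lemma totalDegree_affineLayerPoly_le {W L d : ℕ} (ℓ : Fin (L + 1))
    (P : Fin W → MvPolynomial (WeightIndex W L) ℝ) (hP : ∀ j, (P j).totalDegree ≤ d) (i : Fin W) :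
    (affineLayerPoly ℓ P i).totalDegree ≤ d + 1 := by
  refine (MvPolynomial.totalDegree_add _ _).trans (max_le ?_ (by simp))
  refine MvPolynomial.totalDegree_finsetSum_le fun j _ => ?_
  refine (MvPolynomial.totalDegree_mul _ _).trans ?_
  rw [MvPolynomial.totalDegree_X, add_comm]
  exact Nat.add_le_add_right (hP j) 1

/-- The bound on the number of sign patterns of `m` polynomials of degree at most `L + 1` in the
weights. -/
def signPatternBound (W L m : ℕ) : ℕ :=
  (Fintype.card (WeightIndex W L) * (m * (L + 1) + 2) + 1) ^ Fintype.card (WeightIndex W L)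

lemma ncard_range_sign_patterns_le_signPatternBound {W L m : ℕ} {κ : Type*} [Fintype κ]
    (hm : Fintype.card κ ≤ m) (p : κ → MvPolynomial (WeightIndex W L) ℝ)
    (hp : ∀ k, (p k).totalDegree ≤ L + 1) :
    (Set.range fun θ k => 0 < MvPolynomial.eval θ (p k)).ncard ≤ signPatternBound W L m := by
  refine (ncard_range_sign_patterns_le p hp).trans ?_
  unfold signPatternBound
  gcongr

open Classical in
/-- The activations at finitely many inputs are given by few tuples of polynomials in the
weights. -/
lemma exists_activation_cover {W L m : ℕ} {κ : Type*} [Fintype κ]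
    (hm : Fintype.card (Fin W × κ) ≤ m) (v : κ → Fin W → ℝ) (ℓ : ℕ) (hℓ : ℓ ≤ L) :
    ∃ Ps : Finset (κ → Fin W → MvPolynomial (WeightIndex W L) ℝ),
      Ps.card ≤ signPatternBound W L m ^ ℓ ∧ (∀ P ∈ Ps, ∀ n i, (P n i).totalDegree ≤ ℓ) ∧
      ∀ θ, ∃ P ∈ Ps, ∀ n i,
        activation θ (v n) ℓ i = MvPolynomial.eval (weightVector L θ) (P n i) := by
  induction ℓ with
  | zero =>
    refine ⟨{fun n i => MvPolynomial.C (v n i)}, by simp, ?_, fun θ => ?_⟩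
    · intro P hP n i
      rw [Finset.mem_singleton.mp hP, MvPolynomial.totalDegree_C]
    · exact ⟨_, Finset.mem_singleton_self _, fun n i => by simp [activation]⟩
  | succ ℓ ih =>
    obtain ⟨Ps, hcard, hdeg, hcov⟩ := ih (by omega)
    let l : Fin (L + 1) := ⟨ℓ, by omega⟩
    let Q (P : κ → Fin W → MvPolynomial (WeightIndex W L) ℝ) :
        Fin W × κ → MvPolynomial (WeightIndex W L) ℝ := fun a => affineLayerPoly l (P a.2) a.1
    let S (P : κ → Fin W → MvPolynomial (WeightIndex W L) ℝ) :=
      Set.range fun θ a => 0 < MvPolynomial.eval θ (Q P a)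
    have hQ : ∀ P ∈ Ps, ∀ a, (Q P a).totalDegree ≤ ℓ + 1 := fun P hP a =>
      totalDegree_affineLayerPoly_le _ _ (hdeg P hP a.2) _
    have hS : ∀ P ∈ Ps, (S P).toFinset.card ≤ signPatternBound W L m := fun P hP => by
      rw [← Set.ncard_eq_toFinset_card']
      exact ncard_range_sign_patterns_le_signPatternBound hm (Q P)
        fun a => (hQ P hP a).trans (by omega)
    refine ⟨Ps.biUnion fun P => (S P).toFinset.image fun σ n i => if σ (i, n) then Q P (i, n) else 0,
      ?_, ?_, fun θ => ?_⟩
    · rw [pow_succ]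
      exact (Finset.card_biUnion_le_card_mul _ _ _ fun P hP => Finset.card_image_le.trans (hS P hP)).trans
        (Nat.mul_le_mul_right _ hcard)
    · intro P' hP' n i
      obtain ⟨P, hP, hP'⟩ := Finset.mem_biUnion.mp hP'
      obtain ⟨σ, -, rfl⟩ := Finset.mem_image.mp hP'
      by_cases h : σ (i, n)
      · simp only [h, if_true]; exact hQ P hP _
      · simp [h]
    · obtain ⟨P, hP, hPθ⟩ := hcov θ
      refine ⟨_, Finset.mem_biUnion.mpr ⟨P, hP, Finset.mem_image_of_mem _
        (Set.mem_toFinset.mpr ⟨weightVector L θ, rfl⟩)⟩, fun n i => ?_⟩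
      have h : MvPolynomial.eval (weightVector L θ) (Q P (i, n)) =
          affineLayer (θ ℓ) (activation θ (v n) ℓ) i := by
        rw [eval_affineLayerPoly, ← funext (hPθ n)]
      simp only [activation, relu, ← h]
      split_ifs with h0
      · exact max_eq_left h0.le
      · rw [map_zero]; exact max_eq_right (not_lt.mp h0)

/-- If networks with `L` hidden layers of width `W` realize all functions `κ → {0, …, K}` at
`|κ|` inputs, then the number of these functions is bounded in terms of sign patterns. -/
lemma card_interpolated_le {W L K : ℕ} {κ : Type*} [Fintype κ] (hW : 1 ≤ W) (hK : 1 ≤ K)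
    (v : κ → Fin W → ℝ) (o : Fin W)
    (H : ∀ x : κ → Fin (K + 1), ∃ θ, ∀ n,
      affineLayer (θ L) (activation θ (v n) L) o = ((x n : ℕ) : ℝ)) :
    (K + 1) ^ Fintype.card κ ≤
      signPatternBound W L (W * Fintype.card κ * K) ^ (L + 1) := by
  classical
  obtain ⟨Ps, hcard, hdeg, hcov⟩ := exists_activation_cover (W := W) (L := L)
    (m := W * Fintype.card κ * K)
    (by simpa using Nat.le_mul_of_pos_right (W * Fintype.card κ) hK) v L le_rfl
  let Q (P : κ → Fin W → MvPolynomial (WeightIndex W L) ℝ) :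
      κ × Fin K → MvPolynomial (WeightIndex W L) ℝ := fun a =>
    affineLayerPoly (Fin.last L) (P a.1) o - MvPolynomial.C ((a.2 : ℕ) : ℝ)
  let S (P : κ → Fin W → MvPolynomial (WeightIndex W L) ℝ) :=
    Set.range fun θ a => 0 < MvPolynomial.eval θ (Q P a)
  have hS : ∀ P ∈ Ps, (S P).toFinset.card ≤ signPatternBound W L (W * Fintype.card κ * K) := by
    intro P hP
    rw [← Set.ncard_eq_toFinset_card']
    refine ncard_range_sign_patterns_le_signPatternBound ?_ (Q P) fun a =>
      (MvPolynomial.totalDegree_sub_C_le _ _).trans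
        (totalDegree_affineLayerPoly_le _ _ (hdeg P hP a.1) _)
    simp only [Fintype.card_prod, Fintype.card_fin]
    exact Nat.mul_le_mul_right _ (Nat.le_mul_of_pos_left _ hW)
  choose θ hθ using H
  choose P hP hPθ using fun x => hcov (θ x)
  have heval : ∀ x a, MvPolynomial.eval (weightVector L (θ x)) (Q (P x) a) =
      ((x a.1 : ℕ) : ℝ) - ((a.2 : ℕ) : ℝ) := by
    intro x a
    simp only [Q, map_sub, MvPolynomial.eval_C]
    rw [eval_affineLayerPoly, ← funext (hPθ x a.1), Fin.val_last, hθ]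
  let Ψ : (κ → Fin (K + 1)) →
      (_ : κ → Fin W → MvPolynomial (WeightIndex W L) ℝ) × (κ × Fin K → Prop) := fun x =>
    ⟨P x, fun a => 0 < MvPolynomial.eval (weightVector L (θ x)) (Q (P x) a)⟩
  have hΨ : Function.Injective Ψ := by
    intro x y hxy
    have h2 := (Sigma.mk.inj_iff.mp hxy).2
    have h3 : ∀ a : κ × Fin K, (a.2 : ℕ) < (x a.1 : ℕ) ↔ (a.2 : ℕ) < (y a.1 : ℕ) := by
      intro a
      have := congrFun (eq_of_heq h2) a
      simp only [heval, sub_pos, Nat.cast_lt] at this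
      exact iff_of_eq this
    funext n
    apply Fin.ext
    by_contra hne
    rcases lt_or_gt_of_ne hne with h | h
    · have := (h3 (n, ⟨x n, by omega⟩)).mpr h
      simp at this
    · have := (h3 (n, ⟨y n, by omega⟩)).mp h
      simp at this
  calc (K + 1) ^ Fintype.card κ = (Finset.univ : Finset (κ → Fin (K + 1))).card := by simp
    _ ≤ (Ps.sigma fun P => (S P).toFinset).card :=
        Finset.card_le_card_of_injOn Ψ (fun x _ => Finset.mem_coe.mpr (Finset.mem_sigma.mpr
          ⟨hP x, Set.mem_toFinset.mpr ⟨_, rfl⟩⟩)) hΨ.injOn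
    _ ≤ Ps.card * signPatternBound W L (W * Fintype.card κ * K) := by
        rw [Finset.card_sigma]
        exact Finset.sum_le_card_nsmul _ _ _ hS
    _ ≤ _ := by
        rw [pow_succ]
        exact Nat.mul_le_mul_right _ hcard

lemma signPatternBound_le {W L M m : ℕ} (hW : 2 ≤ W) (hL : 1 ≤ L) (hM : 1 ≤ M) (hm : m ≤ W * M) :
    signPatternBound W L m ^ (L + 1) ≤ ((W * L) ^ 7 * M) ^ (8 * (W * L) ^ 2) := by
  have hX : 2 ≤ W * L := by nlinarith
  have hcard : Fintype.card (WeightIndex W L) = (L + 1) * (W * (W + 1)) := by simp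
  have hn : (L + 1) * (W * (W + 1)) ≤ 4 * (L * W ^ 2) := by
    calc (L + 1) * (W * (W + 1)) ≤ (2 * L) * (W * (2 * W)) := by gcongr <;> omega
      _ = _ := by ring
  have hn' : (L + 1) * (W * (W + 1)) ≤ 4 * (W * L) ^ 2 := by
    refine hn.trans ?_
    calc 4 * (L * W ^ 2) ≤ 4 * (L * W ^ 2) * L := Nat.le_mul_of_pos_right _ hL
      _ = _ := by ring
  have hb : (L + 1) * (W * (W + 1)) * (m * (L + 1) + 2) + 1 ≤ (W * L) ^ 7 * M := by
    set X := W * L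
    have h1 : m * (L + 1) + 2 ≤ 3 * (X * M) := by
      have h2 : m * (L + 1) ≤ W * M * (2 * L) := Nat.mul_le_mul hm (by omega)
      have h3 : W * M * (2 * L) = 2 * (X * M) := by simp only [X]; ring
      have h4 : 2 ≤ X * M := by nlinarith
      omega
    have h5 : 1 ≤ X ^ 3 * M := Nat.mul_pos (by positivity) hM
    calc _ ≤ 4 * X ^ 2 * (3 * (X * M)) + 1 := by gcongr
      _ = 12 * (X ^ 3 * M) + 1 := by ring
      _ ≤ 2 ^ 4 * (X ^ 3 * M) := by omega
      _ ≤ X ^ 4 * (X ^ 3 * M) := by gcongr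
      _ = _ := by ring
  have he : (L + 1) * (W * (W + 1)) * (L + 1) ≤ 8 * (W * L) ^ 2 := by
    calc _ ≤ 4 * (L * W ^ 2) * (2 * L) := by gcongr; omega
      _ = _ := by ring
  rw [signPatternBound, hcard, ← pow_mul]
  calc _ ≤ ((W * L) ^ 7 * M) ^ ((L + 1) * (W * (W + 1)) * (L + 1)) := Nat.pow_le_pow_left hb _
    _ ≤ _ := Nat.pow_le_pow_right (by positivity) he

/-- If `N ≤ 24 X ^ 2 (log M + 7 log X)` where `M` is polynomially bounded in `N`, then `log M` is
at most of the order of `log X`. -/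
lemma exists_log_le_mul_log (p C₀ : ℝ) (hp : 1 ≤ p) (hC₀ : 0 < C₀) :
    ∃ H : ℝ, 0 ≤ H ∧ ∀ N M X : ℝ, 1 ≤ N → N ≤ M → M ≤ C₀ * N ^ p → 2 ≤ X →
      N ≤ 24 * X ^ 2 * (Real.log M + 7 * Real.log X) → Real.log M ≤ H * Real.log X := by
  set A := |Real.log C₀| with hA
  have hA0 : 0 ≤ A := abs_nonneg _
  set B := 24 * (A + 4 * p + 28) with hB
  have hB1 : 1 ≤ B := by rw [hB]; linarith
  have hlB : 0 ≤ Real.log B := Real.log_nonneg hB1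
  refine ⟨2 * A + 4 * p + 8 * p * Real.log B, by positivity, fun N M X hN hNM hM hX h => ?_⟩
  have hN0 : 0 < N := by linarith
  have hlX : 1 / 2 ≤ Real.log X := by
    have := Real.log_two_gt_d9
    have := Real.log_le_log two_pos hX
    linarith
  have hlM : Real.log M ≤ A + p * Real.log N := by
    calc Real.log M ≤ Real.log (C₀ * N ^ p) := Real.log_le_log (by linarith) hM
      _ = Real.log C₀ + p * Real.log N := by
        rw [Real.log_mul hC₀.ne' (by positivity), Real.log_rpow hN0]
      _ ≤ _ := by gcongr; exact le_abs_self _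
  rcases le_total N (X ^ 4) with hc | hc
  · have h1 : Real.log N ≤ 4 * Real.log X := by
      calc _ ≤ Real.log (X ^ 4) := Real.log_le_log hN0 hc
        _ = _ := by rw [Real.log_pow]; norm_num
    nlinarith [mul_nonneg (mul_nonneg (show 0 ≤ p by linarith) hlB) (show 0 ≤ Real.log X by linarith)]
  · obtain ⟨y, hy1, rfl⟩ : ∃ y : ℝ, 1 ≤ y ∧ N = y ^ 4 := by
      refine ⟨N ^ (1 / 4 : ℝ), Real.one_le_rpow hN (by norm_num), ?_⟩
      rw [← Real.rpow_natCast, ← Real.rpow_mul hN0.le]; norm_num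
    have hy0 : 0 < y := by linarith
    have hXy : X ≤ y := le_of_pow_le_pow_left₀ (by norm_num) hy0.le hc
    have hly : Real.log (y ^ 4) = 4 * Real.log y := by rw [Real.log_pow]; norm_num
    have hly' : Real.log y ≤ y := (Real.log_le_sub_one_of_pos hy0).trans (by linarith)
    have hlXy : Real.log X ≤ y := (Real.log_le_log (by linarith) hXy).trans hly'
    have h1 : Real.log M + 7 * Real.log X ≤ (A + 4 * p + 28) * y := by
      rw [hly] at hlM
      nlinarith
    have h2 : y ^ 4 ≤ B * y ^ 3 := by
      have h3 : 0 ≤ Real.log M := Real.log_nonneg (by linarith)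
      calc y ^ 4 ≤ 24 * X ^ 2 * (Real.log M + 7 * Real.log X) := h
        _ ≤ 24 * y ^ 2 * ((A + 4 * p + 28) * y) := by gcongr
        _ = _ := by rw [hB]; ring
    have h3 : y ≤ B := by
      have : 0 < y ^ 3 := by positivity
      nlinarith
    have h4 : Real.log y ≤ Real.log B := Real.log_le_log hy0 h3
    rw [hly] at hlM
    have h5 : Real.log M ≤ A + 4 * p * Real.log B := by nlinarith
    nlinarith [mul_nonneg (mul_nonneg (show 0 ≤ p by linarith) hlB) (show 0 ≤ Real.log X - 1 / 2 by linarith)]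

theorem rep_lower_bound_dense (p C₀ : ℝ) (hp : 1 ≤ p) (hC₀ : 0 < C₀) :
    ∃ c : ℝ, 0 < c ∧
      ∀ N M W L : ℕ, 2 ≤ W → 1 ≤ L → N ≤ M → (M : ℝ) ≤ C₀ * (N : ℝ) ^ p →
        (∀ x : Fin N → ℤ, ∑ n, |x n| ≤ (M : ℤ) →
          ∃ g ∈ NN 1 1 W L, ∀ n : Fin N, g (fun _ => (n : ℝ) + 1) 0 = x n) →
        c * N * (1 + Real.log ((M : ℝ) / N)) ≤
          (W : ℝ) ^ 2 * (L : ℝ) ^ 2 * Real.log ((W : ℝ) * L) := by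
  obtain ⟨H, hH0, hH⟩ := exists_log_le_mul_log p C₀ hp hC₀
  refine ⟨1 / (24 * (H + 7)), by positivity, fun N M W L hW hL hNM hM hrep => ?_⟩
  have hX2 : (2 : ℝ) ≤ (W : ℝ) * L := by
    have : 2 ≤ W * L := by nlinarith
    exact_mod_cast this
  have hlX : 0 ≤ Real.log ((W : ℝ) * L) := Real.log_nonneg (by linarith)
  rcases Nat.eq_zero_or_pos N with rfl | hN
  · simp only [Nat.cast_zero, mul_zero, zero_mul]
    positivity
  have hM1 : 1 ≤ M := hN.trans_le hNM
  set K := M / N with hK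
  have hK1 : 1 ≤ K := (Nat.one_le_div_iff hN).mpr hNM
  have hNK : N * K ≤ M := Nat.mul_div_le M N
  have hcount : (K + 1) ^ N ≤ ((W * L) ^ 7 * M) ^ (8 * (W * L) ^ 2) := by
    have hW1 : 1 ≤ W := by omega
    refine le_trans ?_ (signPatternBound_le hW hL hM1 (m := W * N * K)
      (by rw [mul_assoc]; exact Nat.mul_le_mul_left _ hNK))
    have := card_interpolated_le (L := L) hW1 hK1 (fun (n : Fin N) _ => ((n : ℕ) : ℝ) + 1)
      (Fin.castLE hW1 0) fun x => ?_
    · simpa using this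
    obtain ⟨g, hg, hgx⟩ := hrep (fun n => ((x n : ℕ) : ℤ)) (by
      refine le_trans (Finset.sum_le_card_nsmul _ _ (K : ℤ) fun n _ => ?_) ?_
      · rw [Nat.abs_cast]; exact_mod_cast Nat.lt_succ_iff.mp (x n).2
      · simpa using (by exact_mod_cast hNK : (N : ℤ) * K ≤ M))
    obtain ⟨θ, hθ⟩ := exists_weights_of_mem_NNaux hW1 L 1 hW1 g hg
    refine ⟨θ, fun n => ?_⟩
    rw [← hθ]
    simpa using hgx n
  have hNr : (1 : ℝ) ≤ N := by exact_mod_cast hN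
  have hMr : (1 : ℝ) ≤ M := by exact_mod_cast hM1
  have hKr : (1 : ℝ) ≤ K := by exact_mod_cast hK1
  have hlog : N * Real.log (K + 1) ≤
      8 * ((W : ℝ) * L) ^ 2 * (Real.log M + 7 * Real.log ((W : ℝ) * L)) := by
    have h1 : ((K : ℝ) + 1) ^ N ≤ (((W : ℝ) * L) ^ 7 * M) ^ (8 * (W * L) ^ 2) := by
      exact_mod_cast hcount
    have h2 := Real.log_le_log (by positivity) h1
    rw [Real.log_pow, Real.log_pow, Real.log_mul (by positivity) (by positivity), Real.log_pow] at h2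
    push_cast at h2
    linarith
  have hdiv : 1 + Real.log ((M : ℝ) / N) ≤ 3 * Real.log (K + 1) := by
    have h1 : (M : ℝ) / N ≤ K + 1 := by
      rw [div_le_iff₀ (by positivity), mul_comm]
      exact_mod_cast (Nat.lt_mul_div_succ M hN).le
    have h2 := Real.log_le_log (by positivity) h1
    have h3 := Real.log_le_log two_pos (show (2 : ℝ) ≤ K + 1 by linarith)
    have := Real.log_two_gt_d9
    linarith
  have hmain : N * (1 + Real.log ((M : ℝ) / N)) ≤
      24 * ((W : ℝ) * L) ^ 2 * (Real.log M + 7 * Real.log ((W : ℝ) * L)) := by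
    calc _ ≤ N * (3 * Real.log (K + 1)) := by gcongr
      _ ≤ _ := by linarith
  have hlM := hH N M ((W : ℝ) * L) hNr (by exact_mod_cast hNM) hM hX2 (le_trans (by
    have : 0 ≤ Real.log ((M : ℝ) / N) :=
      Real.log_nonneg ((one_le_div (by positivity)).mpr (by exact_mod_cast hNM))
    nlinarith) hmain)
  rw [mul_assoc, div_mul_eq_mul_div, one_mul, div_le_iff₀ (by positivity)]
  calc _ ≤ 24 * ((W : ℝ) * L) ^ 2 * (Real.log M + 7 * Real.log ((W : ℝ) * L)) := hmain
    _ ≤ 24 * ((W : ℝ) * L) ^ 2 *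
        (H * Real.log ((W : ℝ) * L) + 7 * Real.log ((W : ℝ) * L)) := by gcongr
    _ = _ := by ring
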